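/- Let F be a standard discrete distribution on V = {0, ε, …, 1} with monopolist price x, values drawn i.i.d. from F, and let M be a revenue-maximizing moral mechanism (profit maximizer) with potential payment functions p_{-1},…,p_{-n}. Let v_{-i} ∈ V^{n−1} satisfy: max(v_{-i}) ≥ x; for every player j and every v̂_{-j} ≻ v_{-i}, p_{-j}(v̂_{-j}) ≥ max(v̂_{-j}); and p_{-i}(v_{-i}) < max(v_{-i}). Set v_i = p_{-i}(v_{-i}) and suppose that in the instance (v_i, v_{-i}), for every player k ≠ i it holds that p_{-k}(v_{-k}) > v_k. Let j be the player with the highest value in v_{-i}. Then the mechanism M' whose potential payment functions are identical to those of M except that p'_{-i}(v_{-i}) = p_{-i}(v_{-i}) + ε and p'_{-j}(v_{-j}) = v_j has expected revenue not lower than that of M. -/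

import Mathlib

open scoped NNReal ENNReal
open Finset

/-- A moral mechanism, in its equivalent description as a profit maximizer: an individually
rational, payment independent single-item mechanism with no positive transfers, described by
its potential payment functions `pp i` (the payment of player `i` if he wins, given the
others' values; `⊤` if he can never win) together with an allocation rule that gives the item
to a player with maximal nonnegative potential profit `vᵢ − pp i v`, and allocates whenever
some player has strictly positive potential profit. -/
structure PM (n : ℕ) where
  pp : Fin n → (Fin n → ℝ≥0) → ℝ≥0∞
  alloc : (Fin n → ℝ≥0) → Option (Fin n)
  indep : ∀ (i : Fin n) (v : Fin n → ℝ≥0) (r : ℝ≥0),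
    pp i (Function.update v i r) = pp i v
  ir : ∀ (v : Fin n → ℝ≥0) (i : Fin n), alloc v = some i → pp i v ≤ (v i : ℝ≥0∞)
  maxProfit : ∀ (v : Fin n → ℝ≥0) (i : Fin n), alloc v = some i →
    ∀ j : Fin n, (v j : ℝ≥0∞) + pp i v ≤ (v i : ℝ≥0∞) + pp j v
  sells : ∀ v : Fin n → ℝ≥0, (∃ i, pp i v < (v i : ℝ≥0∞)) → alloc v ≠ none

namespace PM

variable {n : ℕ}

/-- The revenue of a profit maximizer in a given instance: the winner pays his potential
payment, and the revenue is `0` if the item is unallocated. -/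
noncomputable def rev (M : PM n) (v : Fin n → ℝ≥0) : ℝ :=
  match M.alloc v with
  | some i => (M.pp i v).toReal
  | none => 0

/-- Expected revenue when the `n` values are drawn i.i.d. from the discrete distribution
with pdf `g` on the grid `{0, ε, 2ε, …, mε}`. -/
noncomputable def expRev (m : ℕ) (ε : ℝ≥0) (g : ℕ → ℝ) (M : PM n) : ℝ :=
  ∑ k : Fin n → Fin (m + 1),
    (∏ i, g ((k i : ℕ))) * M.rev (fun i => ((k i : ℕ) : ℝ≥0) * ε)

/-- `M` maximizes expected revenue among all moral mechanisms (profit maximizers). -/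
def RevMax (m : ℕ) (ε : ℝ≥0) (g : ℕ → ℝ) (M : PM n) : Prop :=
  ∀ M' : PM n, expRev m ε g M' ≤ expRev m ε g M

/-- All coordinates of `v` belong to the grid `{0, ε, 2ε, …, mε}`. -/
def OnGrid (m : ℕ) (ε : ℝ≥0) (v : Fin n → ℝ≥0) : Prop :=
  ∀ i, ∃ k ≤ m, v i = (k : ℝ≥0) * ε

/-- `max(v₋ᵢ)` : the largest entry of `v` outside coordinate `i`. -/
noncomputable def maxOther (i : Fin n) (v : Fin n → ℝ≥0) : ℝ≥0 :=
  (Finset.univ.erase i).sup v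

/-- The entries of `v` outside coordinate `i`, sorted in decreasing order. -/
noncomputable def sortedDel (i : Fin n) (v : Fin n → ℝ≥0) : List ℝ≥0 :=
  List.insertionSort (· ≥ ·) ((List.ofFn v).eraseIdx (i : ℕ))

/-- `w₋ⱼ ≻ v₋ᵢ` : the decreasingly sorted entries of `w` outside `j` are lexicographically
greater than the decreasingly sorted entries of `v` outside `i`. -/
def SuccOrd (j : Fin n) (w : Fin n → ℝ≥0) (i : Fin n) (v : Fin n → ℝ≥0) : Prop :=
  List.Lex (· < ·) (sortedDel i v) (sortedDel j w)

/-- `x` is (the index of) the monopolist price of the distribution with pdf `g` on the grid: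
`x·ε` maximizes `p·(1 − F(p − ε))` over grid prices `p`. -/
def MonopolistIdx (m : ℕ) (ε : ℝ≥0) (g : ℕ → ℝ) (x : ℕ) : Prop :=
  x ≤ m ∧ ∀ k ≤ m,
    (k : ℝ) * (ε : ℝ) * (1 - ∑ j ∈ Finset.range k, g j) ≤
      (x : ℝ) * (ε : ℝ) * (1 - ∑ j ∈ Finset.range x, g j)

/-- The distribution with pdf `g` on the grid `{0, ε, …, mε}` is standard. -/
def StandardD (m : ℕ) (ε : ℝ≥0) (g : ℕ → ℝ) : Prop :=
  ∀ k k' : ℕ, k ≤ m → k' < k →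
    (k' : ℝ) * (ε : ℝ) - (ε : ℝ) * (1 - ∑ j ∈ Finset.range (k + 1), g j) / g k' ≤
      (k : ℝ) * (ε : ℝ) - (ε : ℝ) * (1 - ∑ j ∈ Finset.range (k + 1), g j) / g k

end PM

namespace PM

section Lex

lemma lex_orderedInsert {x y : ℝ≥0} (h : x < y) (s : List ℝ≥0)
    (hs : s.Pairwise (· ≥ ·)) :
    List.Lex (· < ·) (s.orderedInsert (· ≥ ·) x) (s.orderedInsert (· ≥ ·) y) := by
  induction s with
  | nil => exact List.Lex.rel h
  | cons a t ih =>
    have ih := ih (List.Pairwise.of_cons hs)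
    rw [List.orderedInsert_cons, List.orderedInsert_cons]
    by_cases hxa : x ≥ a
    · rw [if_pos hxa, if_pos (hxa.trans h.le)]
      exact List.Lex.rel h
    · rw [if_neg hxa]
      by_cases hya : y ≥ a
      · rw [if_pos hya]
        rcases eq_or_lt_of_le hya with rfl | hlt
        · have hins : t.orderedInsert (· ≥ ·) a = a :: t := by
            cases t with
            | nil => rfl
            | cons c u =>
              exact List.orderedInsert_cons_of_le _ _ (List.rel_of_pairwise_cons hs (by simp))
          rw [hins] at ih
          exact List.Lex.cons ih
        · exact List.Lex.rel hlt
      · rw [if_neg hya]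
        exact List.Lex.cons ih

variable {n : ℕ}

lemma coe_eraseIdx_ofFn (i : Fin n) (v : Fin n → ℝ≥0) :
    (((List.ofFn v).eraseIdx (i : ℕ) : List ℝ≥0) : Multiset ℝ≥0) =
      (univ.erase i).val.map v := by
  have hi : (i : ℕ) < (List.ofFn v).length := by simp
  have h1 := List.getElem_cons_eraseIdx_perm hi
  have h2 : (v i ::ₘ (((List.ofFn v).eraseIdx (i : ℕ) : List ℝ≥0) : Multiset ℝ≥0)) =
      v i ::ₘ (univ.erase i).val.map v := by
    rw [← Multiset.map_cons, ← Finset.insert_val_of_notMem (by simp),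
      Finset.insert_erase (mem_univ i), Multiset.cons_coe]
    have h3 : ((List.ofFn v : List ℝ≥0) : Multiset ℝ≥0) = univ.val.map v := by
      rw [Fin.univ_val_map]
    rw [← h3]
    exact Multiset.coe_eq_coe.2 (by simpa using h1)
  exact (Multiset.cons_inj_right _).1 h2

lemma insertionSort_eq_of_perm {s t : List ℝ≥0} (h : s.Perm t) :
    s.insertionSort (· ≥ ·) = t.insertionSort (· ≥ ·) :=
  (((List.perm_insertionSort _ s).trans h).trans
    (List.perm_insertionSort _ t).symm).eq_of_pairwise'
      (List.pairwise_insertionSort _ s) (List.pairwise_insertionSort _ t)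

lemma mem_sortedDel {i : Fin n} {v : Fin n → ℝ≥0} {y : ℝ≥0} :
    y ∈ sortedDel i v ↔ ∃ k, k ≠ i ∧ v k = y := by
  rw [sortedDel, List.mem_insertionSort, ← Multiset.mem_coe, coe_eraseIdx_ofFn]
  simp only [Multiset.mem_map, Finset.mem_val, Finset.mem_erase, mem_univ, and_true]

lemma sortedDel_pairwise (i : Fin n) (v : Fin n → ℝ≥0) :
    (sortedDel i v).Pairwise (· ≥ ·) :=
  List.pairwise_insertionSort _ _

lemma succOrd_of_forall_lt {i l k : Fin n} {v w : Fin n → ℝ≥0} (hk : k ≠ l)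
    (h : ∀ k', k' ≠ i → v k' < w k) : SuccOrd l w i v := by
  have hmem : w k ∈ sortedDel l w := mem_sortedDel.2 ⟨k, hk, rfl⟩
  have hall : ∀ y ∈ sortedDel i v, y < w k := by
    intro y hy
    obtain ⟨k', hk', rfl⟩ := mem_sortedDel.1 hy
    exact h k' hk'
  have hsort := sortedDel_pairwise l w
  unfold SuccOrd
  generalize sortedDel l w = L at hmem hsort
  generalize sortedDel i v = L' at hall
  cases L with
  | nil => simp at hmem
  | cons c u =>
    cases L' with
    | nil => exact List.Lex.nil
    | cons d u' =>
      refine List.Lex.rel ((hall d (by simp)).trans_le ?_)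
      rcases List.mem_cons.1 hmem with h' | h'
      · exact h'.le
      · exact List.rel_of_pairwise_cons hsort h'

lemma succOrd_update {i l : Fin n} {v : Fin n → ℝ≥0} {c : ℝ≥0} (hl : l ≠ i) (h : v l < c) :
    SuccOrd l (Function.update v i c) i v := by
  set T : List ℝ≥0 := (((univ.erase i).erase l).val.map v).toList with hT
  have hTc : (T : Multiset ℝ≥0) = ((univ.erase i).erase l).val.map v := Multiset.coe_toList _
  have h1 : ((List.ofFn v).eraseIdx (i : ℕ)).Perm (v l :: T) := by
    rw [← Multiset.coe_eq_coe, coe_eraseIdx_ofFn, ← Multiset.cons_coe, hTc, ← Multiset.map_cons,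
      ← Finset.insert_val_of_notMem (by simp), Finset.insert_erase (by simp [hl])]
  have h2 : ((List.ofFn (Function.update v i c)).eraseIdx (l : ℕ)).Perm (c :: T) := by
    rw [← Multiset.coe_eq_coe, coe_eraseIdx_ofFn, ← Multiset.cons_coe, hTc]
    have h3 : ((univ.erase i).erase l).val.map v =
        ((univ.erase l).erase i).val.map (Function.update v i c) := by
      rw [Finset.erase_right_comm]
      refine Multiset.map_congr rfl fun k hk => ?_
      have hk' : k ≠ i := (Finset.mem_erase.1 (Finset.mem_def.2 hk)).1
      rw [Function.update_of_ne hk']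
    have h4 : c = Function.update v i c i := by simp
    rw [h3]
    nth_rewrite 2 [h4]
    rw [← Multiset.map_cons,
      ← Finset.insert_val_of_notMem (by simp), Finset.insert_erase (by simp [hl.symm])]
  unfold SuccOrd sortedDel
  rw [insertionSort_eq_of_perm h1, insertionSort_eq_of_perm h2]
  exact lex_orderedInsert h _ (List.pairwise_insertionSort _ _)

lemma le_maxOther {i k : Fin n} (v : Fin n → ℝ≥0) (h : k ≠ i) : v k ≤ maxOther i v :=
  Finset.le_sup (f := v) (by simp [h])

end Lex

section Valid

variable {n : ℕ}

/-- The outcome `o` is compatible with profit maximization in the instance `w` under the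
potential payments `p`. -/
structure Valid (p : Fin n → ℝ≥0∞) (w : Fin n → ℝ≥0) (o : Option (Fin n)) : Prop where
  ir : ∀ i, o = some i → p i ≤ (w i : ℝ≥0∞)
  maxProfit : ∀ i, o = some i → ∀ j, (w j : ℝ≥0∞) + p i ≤ (w i : ℝ≥0∞) + p j
  sells : (∃ i, p i < (w i : ℝ≥0∞)) → o ≠ none

/-- The revenue collected in the outcome `o` under the potential payments `p`. -/
noncomputable def outcomeRev (p : Fin n → ℝ≥0∞) (o : Option (Fin n)) : ℝ :=
  match o with
  | some i => (p i).toReal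
  | none => 0

lemma rev_eq_outcomeRev (M : PM n) (w : Fin n → ℝ≥0) :
    M.rev w = outcomeRev (fun l => M.pp l w) (M.alloc w) := rfl

lemma valid_alloc (M : PM n) (w : Fin n → ℝ≥0) : Valid (fun l => M.pp l w) w (M.alloc w) :=
  ⟨M.ir w, M.maxProfit w, M.sells w⟩

lemma Valid.of_modify {p p' : Fin n → ℝ≥0∞} {w : Fin n → ℝ≥0} {o : Option (Fin n)}
    (h : Valid p w o)
    (hp : ∀ l, p' l = p l ∨ (o ≠ some l ∧ (p l ≤ p' l ∨ (w l : ℝ≥0∞) ≤ p' l))) :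
    Valid p' w o := by
  have hsame : ∀ l, o = some l → p' l = p l := fun l hl =>
    (hp l).resolve_right fun h' => h'.1 hl
  refine ⟨fun l hl => hsame l hl ▸ h.ir l hl, fun l hl k => ?_, ?_⟩
  · rw [hsame l hl]
    rcases hp k with hk | ⟨-, hk | hk⟩
    · rw [hk]; exact h.maxProfit l hl k
    · exact (h.maxProfit l hl k).trans (by gcongr)
    · rw [add_comm]
      exact add_le_add (h.ir l hl) hk
  · rintro ⟨l, hl⟩
    rcases hp l with hk | ⟨-, hk | hk⟩
    · exact h.sells ⟨l, hk ▸ hl⟩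
    · exact h.sells ⟨l, hk.trans_lt hl⟩
    · exact absurd hl (not_lt.2 hk)

lemma exists_valid_some {p : Fin n → ℝ≥0∞} {w : Fin n → ℝ≥0}
    (h : ∃ i, p i ≤ (w i : ℝ≥0∞)) : ∃ l, Valid p w (some l) := by
  classical
  obtain ⟨i, hi⟩ := h
  obtain ⟨l, hl, hmax⟩ := Finset.exists_max_image
    (univ.filter fun i => p i ≤ (w i : ℝ≥0∞)) (fun i => (w i : ℝ) - (p i).toReal)
    ⟨i, by simp [hi]⟩
  have hl : p l ≤ w l := by simpa using hl
  refine ⟨l, ⟨?_, ?_, by simp⟩⟩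
  · rintro _ ⟨⟩; exact hl
  · rintro _ ⟨⟩ k
    by_cases hk : p k ≤ w k
    · have h1 := hmax k (by simp [hk])
      obtain ⟨a, ha⟩ := WithTop.ne_top_iff_exists.1 (ne_top_of_le_ne_top ENNReal.coe_ne_top hl)
      obtain ⟨b, hb⟩ := WithTop.ne_top_iff_exists.1 (ne_top_of_le_ne_top ENNReal.coe_ne_top hk)
      have ha : (a : ℝ≥0∞) = p l := ha
      have hb : (b : ℝ≥0∞) = p k := hb
      rw [← ha, ← hb] at h1 ⊢
      simp only [ENNReal.coe_toReal] at h1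
      norm_cast
      rw [← NNReal.coe_le_coe]
      push_cast
      linarith
    · rw [add_comm]
      exact add_le_add hl (not_le.1 hk).le

lemma exists_valid (p : Fin n → ℝ≥0∞) (w : Fin n → ℝ≥0) : ∃ o, Valid p w o := by
  by_cases h : ∃ i, p i ≤ (w i : ℝ≥0∞)
  · obtain ⟨l, hl⟩ := exists_valid_some h
    exact ⟨_, hl⟩
  · refine ⟨none, ⟨by simp, by simp, fun ⟨i, hi⟩ => absurd ⟨i, hi.le⟩ h⟩⟩

lemma exists_mechanism (p : Fin n → (Fin n → ℝ≥0) → ℝ≥0∞)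
    (hp : ∀ i v r, p i (Function.update v i r) = p i v)
    (Q : (Fin n → ℝ≥0) → Option (Fin n) → Prop)
    (h : ∀ w, ∃ o, Valid (fun l => p l w) w o ∧ Q w o) :
    ∃ M' : PM n, M'.pp = p ∧ ∀ w, Q w (M'.alloc w) := by
  choose o ho using h
  exact ⟨⟨p, o, hp, fun v => (ho v).1.ir, fun v => (ho v).1.maxProfit,
    fun v => (ho v).1.sells⟩, rfl, fun w => (ho w).2⟩

/-- Raising the potential payment of a winner `i` who still has nonnegative profit, when every
player with nonnegative profit has value at least that of `i`. -/
lemma Valid.exists_of_raise {p p' : Fin n → ℝ≥0∞} {w : Fin n → ℝ≥0} {i : Fin n}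
    (h : Valid p w (some i)) (hne : ∀ l, l ≠ i → p' l = p l)
    (hle : p' i ≤ w i) (hw : ∀ l, l ≠ i → p l ≤ w l → w i ≤ w l) :
    ∃ l, Valid p' w (some l) ∧ (l = i ∨ (l ≠ i ∧ p i ≤ p l ∧
      (p l = p i → Valid p w (some l)))) := by
  obtain ⟨l, hl⟩ := exists_valid_some ⟨i, hle⟩
  refine ⟨l, hl, ?_⟩
  by_cases hli : l = i
  · exact Or.inl hli
  · right
    have hpl : p l ≤ w l := hne l hli ▸ hl.ir l rfl
    have hwl := hw l hli hpl
    have h1 := h.maxProfit i rfl l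
    have hwl' : (w i : ℝ≥0∞) ≤ w l := by exact_mod_cast hwl
    refine ⟨hli, ?_, fun heq => ⟨?_, ?_, by simp⟩⟩
    · exact (ENNReal.add_le_add_iff_left ENNReal.coe_ne_top).1
        ((add_le_add_left hwl' (p i)).trans h1)
    · rintro _ ⟨⟩; exact hpl
    · rintro _ ⟨⟩ k
      rw [heq]
      exact (h.maxProfit i rfl k).trans (by gcongr)

end Valid

section Tail

variable {m : ℕ} {ε : ℝ≥0} {g : ℕ → ℝ}

lemma one_sub_sum_range (hgsum : ∑ k ∈ range (m + 1), g k = 1) {k : ℕ} (hk : k ≤ m + 1) :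
    1 - ∑ j ∈ range k, g j = ∑ s ∈ Ico k (m + 1), g s := by
  rw [← hgsum, Finset.sum_Ico_eq_sub _ hk]

lemma tail_succ {k : ℕ} (hk : k ≤ m) :
    ∑ s ∈ Ico k (m + 1), g s = g k + ∑ s ∈ Ico (k + 1) (m + 1), g s :=
  Finset.sum_eq_sum_Ico_succ_bot (by omega) g

lemma tail_anti (hg : ∀ k ≤ m, 0 < g k) {k l : ℕ} (h : k ≤ l) :
    ∑ s ∈ Ico l (m + 1), g s ≤ ∑ s ∈ Ico k (m + 1), g s := by
  refine Finset.sum_le_sum_of_subset_of_nonneg (Finset.Ico_subset_Ico_left h) fun s hs _ => ?_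
  exact (hg s (by have := Finset.mem_Ico.1 hs; omega)).le

lemma StandardD.mul_le (hstd : StandardD m ε g) (hε : 0 < ε) (hg : ∀ k ≤ m, 0 < g k)
    (hgsum : ∑ k ∈ range (m + 1), g k = 1) {a b : ℕ} (hb : b ≤ m) (hab : a < b) :
    (∑ s ∈ Ico (b + 1) (m + 1), g s) * (g a - g b) ≤ (b - a : ℝ) * g a * g b := by
  have h := hstd b a hb hab
  rw [one_sub_sum_range hgsum (by omega)] at h
  have ha := hg a (by omega)
  have hb' := hg b hb
  have hε' : (0 : ℝ) < ε := hε
  set S := ∑ s ∈ Ico (b + 1) (m + 1), g s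
  have h2 : (a : ℝ) - S / g a ≤ b - S / g b := by
    refine le_of_mul_le_mul_left ?_ hε'
    calc (ε : ℝ) * (a - S / g a) = a * ε - ε * S / g a := by ring
      _ ≤ b * ε - ε * S / g b := h
      _ = ε * (b - S / g b) := by ring
  have h3 := mul_le_mul_of_nonneg_right h2 (mul_pos ha hb').le
  have e1 : ((a : ℝ) - S / g a) * (g a * g b) = a * g a * g b - S * g b := by field_simp
  have e2 : ((b : ℝ) - S / g b) * (g a * g b) = b * g a * g b - S * g a := by field_simp
  rw [e1, e2] at h3
  linarith

lemma revenue_anti (hstd : StandardD m ε g) (hε : 0 < ε) (hg : ∀ k ≤ m, 0 < g k)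
    (hgsum : ∑ k ∈ range (m + 1), g k = 1) {x : ℕ} (hx : MonopolistIdx m ε g x)
    {b c : ℕ} (hxb : x ≤ b) (hbc : b ≤ c) (hc : c ≤ m) :
    (c : ℝ) * ∑ s ∈ Ico c (m + 1), g s ≤ b * ∑ s ∈ Ico b (m + 1), g s := by
  have hε' : (0 : ℝ) < ε := hε
  have step : ∀ k, x ≤ k → k < m → ∑ s ∈ Ico (k + 1) (m + 1), g s ≤ k * g k := by
    intro k hxk hkm
    have hx0 : ∑ s ∈ Ico (x + 1) (m + 1), g s ≤ x * g x := by
      have h := hx.2 (x + 1) (by omega)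
      rw [one_sub_sum_range hgsum (by omega), one_sub_sum_range hgsum (by omega),
        tail_succ (k := x) (by omega)] at h
      push_cast at h
      refine le_of_mul_le_mul_left ?_ hε'
      linarith
    rcases eq_or_lt_of_le hxk with rfl | hlt
    · exact hx0
    · have h1 := hstd.mul_le hε hg hgsum hkm.le hlt
      have h2 := tail_anti hg (show x + 1 ≤ k + 1 by omega)
      have hgx := hg x (by omega)
      have hgk := hg k (by omega)
      refine le_of_mul_le_mul_right ?_ hgx
      have h3 := mul_le_mul_of_nonneg_right (h2.trans hx0) hgk.le
      linarith
  induction c, hbc using Nat.le_induction with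
  | base => exact le_rfl
  | succ c hbc ih =>
    refine le_trans ?_ (ih (by omega))
    have h := step c (by omega) (by omega)
    rw [tail_succ (k := c) (by omega)]
    push_cast
    linarith

lemma sum_sale_le (hstd : StandardD m ε g) (hε : 0 < ε) (hg : ∀ k ≤ m, 0 < g k)
    (hgsum : ∑ k ∈ range (m + 1), g k = 1) {x : ℕ} (hx : MonopolistIdx m ε g x)
    {b : ℕ} (hxb : x ≤ b) (P : ℝ≥0∞) :
    ∑ s ∈ Ico (b + 1) (m + 1), g s * (if P ≤ ((s * ε : ℝ≥0) : ℝ≥0∞) then P.toReal else 0) ≤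
      (b + 1) * ε * ∑ s ∈ Ico (b + 1) (m + 1), g s := by
  classical
  have hnn : 0 ≤ ∑ s ∈ Ico (b + 1) (m + 1), g s := Finset.sum_nonneg fun s hs =>
    (hg s (by have := Finset.mem_Ico.1 hs; omega)).le
  by_cases hex : ∃ s, b + 1 ≤ s ∧ s ≤ m ∧ P ≤ ((s * ε : ℝ≥0) : ℝ≥0∞)
  · obtain ⟨c, ⟨hbc, hcm, hPc⟩, hmin⟩ : ∃ c, (b + 1 ≤ c ∧ c ≤ m ∧ P ≤ ((c * ε : ℝ≥0) : ℝ≥0∞)) ∧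
        ∀ s, b + 1 ≤ s ∧ s ≤ m ∧ P ≤ ((s * ε : ℝ≥0) : ℝ≥0∞) → c ≤ s :=
      ⟨Nat.find hex, Nat.find_spec hex, fun _ => Nat.find_min' hex⟩
    have hPc' : P.toReal ≤ c * ε := by
      have := ENNReal.toReal_mono ENNReal.coe_ne_top hPc
      simpa using this
    have h1 : ∑ s ∈ Ico (b + 1) (m + 1),
        g s * (if P ≤ ((s * ε : ℝ≥0) : ℝ≥0∞) then P.toReal else 0) ≤
        ∑ s ∈ Ico (b + 1) (m + 1), if c ≤ s then c * ε * g s else 0 := by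
      refine Finset.sum_le_sum fun s hs => ?_
      rw [Finset.mem_Ico] at hs
      have hgs := (hg s (by omega)).le
      by_cases hP : P ≤ ((s * ε : ℝ≥0) : ℝ≥0∞)
      · rw [if_pos hP, if_pos (hmin s ⟨hs.1, by omega, hP⟩), mul_comm]
        exact mul_le_mul_of_nonneg_right hPc' hgs
      · rw [if_neg hP, mul_zero]
        split_ifs <;> positivity
    refine h1.trans ?_
    rw [← Finset.sum_filter]
    have h2 : (Ico (b + 1) (m + 1)).filter (fun s => c ≤ s) = Ico c (m + 1) := by
      ext s; simp only [Finset.mem_filter, Finset.mem_Ico]; omega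
    rw [h2, ← Finset.mul_sum]
    have h3 := revenue_anti hstd hε hg hgsum hx (show x ≤ b + 1 by omega) hbc hcm
    have h4 := mul_le_mul_of_nonneg_right h3 ε.coe_nonneg
    push_cast at h4
    linarith
  · rw [Finset.sum_eq_zero]
    · positivity
    · intro s hs
      rw [Finset.mem_Ico] at hs
      rw [if_neg fun hP => hex ⟨s, hs.1, by omega, hP⟩, mul_zero]

lemma line_gain_nonneg (hstd : StandardD m ε g) (hε : 0 < ε) (hg : ∀ k ≤ m, 0 < g k)
    (hgsum : ∑ k ∈ range (m + 1), g k = 1) {x : ℕ} (hx : MonopolistIdx m ε g x)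
    {a b : ℕ} (hxb : x ≤ b) (hab : a < b) (hb : b ≤ m) (P : ℝ≥0∞) :
    0 ≤ g b * (g a * ((b - a) * ε) + ∑ s ∈ Ico (b + 1) (m + 1), g s * ε) +
      g a * ∑ s ∈ Ico (b + 1) (m + 1),
        g s * (b * ε - if P ≤ ((s * ε : ℝ≥0) : ℝ≥0∞) then P.toReal else 0) := by
  have h1 := sum_sale_le hstd hε hg hgsum hx hxb P
  have h2 := hstd.mul_le hε hg hgsum hb hab
  have ha := hg a (by omega)
  simp only [mul_sub, Finset.sum_sub_distrib]
  rw [← Finset.sum_mul, ← Finset.sum_mul]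
  have h3 := mul_le_mul_of_nonneg_left h1 ha.le
  have h4 := mul_le_mul_of_nonneg_right h2 ε.coe_nonneg
  nlinarith [h3, h4]

end Tail

section ExpectedRevenue

variable {n m : ℕ} {ε : ℝ≥0} {g : ℕ → ℝ}

lemma prod_pdf_pos (hg : ∀ k ≤ m, 0 < g k) (k : Fin n → Fin (m + 1)) :
    0 < ∏ l, g (k l : ℕ) :=
  Finset.prod_pos fun l _ => hg _ (Nat.lt_succ_iff.1 (k l).2)

lemma onGrid_vec (k : Fin n → Fin (m + 1)) :
    OnGrid m ε fun l => ((k l : ℕ) : ℝ≥0) * ε :=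
  fun l => ⟨k l, Nat.lt_succ_iff.1 (k l).2, rfl⟩

lemma expRev_le_of_forall_rev_le (hg : ∀ k ≤ m, 0 < g k) {M M' : PM n}
    (h : ∀ w, OnGrid m ε w → M.rev w ≤ M'.rev w) : expRev m ε g M ≤ expRev m ε g M' :=
  Finset.sum_le_sum fun k _ =>
    mul_le_mul_of_nonneg_left (h _ (onGrid_vec k)) (prod_pdf_pos hg k).le

lemma expRev_lt_of_forall_rev_le (hg : ∀ k ≤ m, 0 < g k) {M M' : PM n}
    (h : ∀ w, OnGrid m ε w → M.rev w ≤ M'.rev w) {w : Fin n → ℝ≥0} (hw : OnGrid m ε w)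
    (hlt : M.rev w < M'.rev w) : expRev m ε g M < expRev m ε g M' := by
  choose k hk hwk using hw
  refine Finset.sum_lt_sum (fun k _ =>
    mul_le_mul_of_nonneg_left (h _ (onGrid_vec k)) (prod_pdf_pos hg k).le)
    ⟨fun l => ⟨k l, Nat.lt_succ_iff.2 (hk l)⟩, mem_univ _, ?_⟩
  refine mul_lt_mul_of_pos_left ?_ (prod_pdf_pos hg _)
  have : (fun l => ((k l : ℕ) : ℝ≥0) * ε) = w := funext fun l => (hwk l).symm
  simpa [this] using hlt

lemma prod_pdf_eq (k : Fin n → Fin (m + 1)) {i j : Fin n} (hji : j ≠ i) :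
    ∏ l, g (k l : ℕ) =
      (∏ l ∈ (univ.erase i).erase j, g (k l : ℕ)) * (g (k i) * g (k j)) := by
  rw [← Finset.mul_prod_erase univ (fun l => g (k l : ℕ)) (mem_univ i),
    ← Finset.mul_prod_erase (univ.erase i) (fun l => g (k l : ℕ)) (a := j) (by simp [hji])]
  ring

lemma sum_filter_fin_lt (h : ℕ → ℝ) (b : ℕ) :
    ∑ s ∈ univ.filter (fun s : Fin (m + 1) => b < (s : ℕ)), h s = ∑ s ∈ Ico (b + 1) (m + 1), h s := by
  rw [Finset.sum_filter, Fin.sum_univ_eq_sum_range (fun s => if b < s then h s else 0) (m + 1),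
    ← Finset.sum_filter]
  congr 1
  ext s
  simp only [Finset.mem_filter, Finset.mem_range, Finset.mem_Ico]
  omega

lemma expRev_le_of_lines (hg : ∀ k ≤ m, 0 < g k) {M M' : PM n} {i j : Fin n} (hji : j ≠ i)
    (K : Fin n → Fin (m + 1)) (hab : (K i : ℕ) < K j) (r : ℕ → ℝ)
    (h0 : M.rev (fun l => ((K l : ℕ) : ℝ≥0) * ε) + ((K j : ℕ) - (K i : ℕ)) * ε ≤
      M'.rev (fun l => ((K l : ℕ) : ℝ≥0) * ε))
    (hI : ∀ t : Fin (m + 1), (K j : ℕ) < t →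
      M.rev (fun l => ((Function.update K i t l : ℕ) : ℝ≥0) * ε) + ε ≤
        M'.rev (fun l => ((Function.update K i t l : ℕ) : ℝ≥0) * ε))
    (hJ : ∀ s : Fin (m + 1), (K j : ℕ) < s →
      M.rev (fun l => ((Function.update K j s l : ℕ) : ℝ≥0) * ε) + ((K j : ℕ) * ε - r s) ≤
        M'.rev (fun l => ((Function.update K j s l : ℕ) : ℝ≥0) * ε))
    (hO : ∀ k : Fin n → Fin (m + 1), (¬ ∃ s, K j < s ∧ Function.update K j s = k) →
      M.rev (fun l => ((k l : ℕ) : ℝ≥0) * ε) ≤ M'.rev (fun l => ((k l : ℕ) : ℝ≥0) * ε))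
    (hgain : 0 ≤ g (K j) * (g (K i) * (((K j : ℕ) - (K i : ℕ)) * ε) +
        ∑ s ∈ Ico ((K j : ℕ) + 1) (m + 1), g s * ε) +
      g (K i) * ∑ s ∈ Ico ((K j : ℕ) + 1) (m + 1), g s * ((K j : ℕ) * ε - r s)) :
    expRev m ε g M ≤ expRev m ε g M' := by
  classical
  set f : (Fin n → Fin (m + 1)) → ℝ := fun k => (∏ l, g (k l : ℕ)) *
    (M'.rev (fun l => ((k l : ℕ) : ℝ≥0) * ε) - M.rev (fun l => ((k l : ℕ) : ℝ≥0) * ε)) with hf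
  have hdiff : expRev m ε g M' - expRev m ε g M = ∑ k, f k := by
    simp only [expRev, hf, mul_sub, Finset.sum_sub_distrib]
  rw [← sub_nonneg, hdiff]
  set G := ∏ l ∈ (univ.erase i).erase j, g (K l : ℕ) with hG
  have hGpos : 0 < G := Finset.prod_pos fun l _ => hg _ (Nat.lt_succ_iff.1 (K l).2)
  have hGI : ∀ t, ∏ l, g (Function.update K i t l : ℕ) = G * (g t * g (K j)) := by
    intro t
    rw [prod_pdf_eq _ hji, Function.update_self, Function.update_of_ne hji]
    congr 1
    refine Finset.prod_congr rfl fun l hl => ?_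
    rw [Function.update_of_ne (by simp at hl; exact hl.2)]
  have hGJ : ∀ s, ∏ l, g (Function.update K j s l : ℕ) = G * (g (K i) * g s) := by
    intro t
    rw [prod_pdf_eq _ hji, Function.update_self, Function.update_of_ne hji.symm]
    congr 1
    refine Finset.prod_congr rfl fun l hl => ?_
    rw [Function.update_of_ne (by simp at hl; exact hl.1)]
  have hfO : ∀ k, (¬ ∃ s, K j < s ∧ Function.update K j s = k) → 0 ≤ f k := fun k hk =>
    mul_nonneg (prod_pdf_pos hg k).le (sub_nonneg.2 (hO k hk))
  have hnot : ∀ t, ¬ ∃ s, K j < s ∧ Function.update K j s = Function.update K i t := by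
    rintro t ⟨s, hs, h⟩
    have := congrFun h j
    rw [Function.update_self, Function.update_of_ne hji] at this
    exact hs.ne' this
  set A := univ.image (Function.update K i) with hA
  set B := (univ.filter fun s : Fin (m + 1) => (K j : ℕ) < s).image (Function.update K j) with hB
  have hdisj : Disjoint A B := by
    rw [Finset.disjoint_left]
    intro k hkA hkB
    obtain ⟨t, -, rfl⟩ := Finset.mem_image.1 hkA
    obtain ⟨s, hs, h⟩ := Finset.mem_image.1 hkB
    exact hnot t ⟨s, by simpa using hs, h⟩
  have hsub : ∑ k ∈ A ∪ B, f k ≤ ∑ k, f k := by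
    refine Finset.sum_le_sum_of_subset_of_nonneg (Finset.subset_univ _) fun k _ hk => hfO k ?_
    rintro ⟨s, hs, rfl⟩
    exact hk (Finset.mem_union_right _ (Finset.mem_image_of_mem _ (by simpa using hs)))
  refine le_trans ?_ hsub
  rw [Finset.sum_union hdisj, hA, hB,
    Finset.sum_image (Function.update_injective K i).injOn,
    Finset.sum_image (Function.update_injective K j).injOn]
  have hIsum : G * (g (K j) * (g (K i) * (((K j : ℕ) - (K i : ℕ)) * ε) +
        ∑ s ∈ Ico ((K j : ℕ) + 1) (m + 1), g s * ε)) ≤ ∑ t, f (Function.update K i t) := by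
    have hpt : ∀ t : Fin (m + 1), (if t = K i then
          G * (g t * g (K j)) * (((K j : ℕ) - (K i : ℕ)) * ε) else 0) +
        (if (K j : ℕ) < t then G * (g t * g (K j)) * ε else 0) ≤ f (Function.update K i t) := by
      intro t
      have hw : 0 ≤ G * (g t * g (K j)) := by
        rw [← hGI]; exact (prod_pdf_pos hg _).le
      by_cases ht : t = K i
      · subst ht
        rw [if_pos rfl, if_neg (by omega), add_zero]
        simp only [hf, hGI]
        refine mul_le_mul_of_nonneg_left ?_ hw
        rw [Function.update_eq_self]
        linarith
      · rw [if_neg ht, zero_add]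
        split_ifs with hbt
        · simp only [hf, hGI]
          refine mul_le_mul_of_nonneg_left ?_ hw
          linarith [hI t hbt]
        · exact hfO _ (hnot t)
    refine le_trans (le_of_eq ?_) (Finset.sum_le_sum fun t _ => hpt t)
    rw [Finset.sum_add_distrib, Finset.sum_ite_eq' univ (K i), if_pos (mem_univ _),
      ← Finset.sum_filter, sum_filter_fin_lt (fun s => G * (g s * g (K j)) * ε) (K j), mul_add,
      mul_add, Finset.mul_sum, Finset.mul_sum]
    congr 1
    · ring
    · exact Finset.sum_congr rfl fun s _ => by ring
  have hJsum : G * (g (K i) * ∑ s ∈ Ico ((K j : ℕ) + 1) (m + 1), g s * ((K j : ℕ) * ε - r s)) ≤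
      ∑ s ∈ univ.filter (fun s : Fin (m + 1) => (K j : ℕ) < s), f (Function.update K j s) := by
    rw [← sum_filter_fin_lt, Finset.mul_sum, Finset.mul_sum]
    refine Finset.sum_le_sum fun s hs => ?_
    have hw : 0 ≤ G * (g (K i) * g s) := by
      rw [← hGJ]; exact (prod_pdf_pos hg _).le
    simp only [hf, hGJ]
    calc _ = G * (g (K i) * g s) * ((K j : ℕ) * ε - r s) := by ring
      _ ≤ _ := mul_le_mul_of_nonneg_left (by linarith [hJ s (by simpa using hs)]) hw
  have := mul_nonneg hGpos.le hgain
  rw [mul_add] at this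
  linarith

end ExpectedRevenue

section SetPay

variable {n : ℕ}

open Classical in
/-- The potential payments `p`, except that player `i` is asked to pay `q` when the others'
values are those of `v`. -/
noncomputable def setPay (p : Fin n → (Fin n → ℝ≥0) → ℝ≥0∞) (i : Fin n) (v : Fin n → ℝ≥0)
    (q : ℝ≥0∞) (l : Fin n) (w : Fin n → ℝ≥0) : ℝ≥0∞ :=
  if l = i ∧ ∀ k, k ≠ i → w k = v k then q else p l w

variable {p : Fin n → (Fin n → ℝ≥0) → ℝ≥0∞} {i : Fin n} {v : Fin n → ℝ≥0} {q : ℝ≥0∞}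

lemma setPay_self {w : Fin n → ℝ≥0} (h : ∀ k, k ≠ i → w k = v k) : setPay p i v q i w = q :=
  if_pos ⟨rfl, h⟩

lemma setPay_of_ne {l : Fin n} (w : Fin n → ℝ≥0) (h : l ≠ i) : setPay p i v q l w = p l w :=
  if_neg fun h' => h h'.1

lemma setPay_of_not {w : Fin n → ℝ≥0} (h : ¬ ∀ k, k ≠ i → w k = v k) (l : Fin n) :
    setPay p i v q l w = p l w :=
  if_neg fun h' => h h'.2

lemma setPay_update (hp : ∀ i v r, p i (Function.update v i r) = p i v) (l : Fin n)
    (w : Fin n → ℝ≥0) (r : ℝ≥0) :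
    setPay p i v q l (Function.update w l r) = setPay p i v q l w := by
  by_cases hl : l = i
  · subst hl
    have hiff : (∀ k, k ≠ l → Function.update w l r k = v k) ↔ ∀ k, k ≠ l → w k = v k :=
      forall_congr' fun k => forall_congr' fun hk => by rw [Function.update_of_ne hk]
    by_cases h : ∀ k, k ≠ l → w k = v k
    · rw [setPay_self h, setPay_self (hiff.2 h)]
    · rw [setPay_of_not h, setPay_of_not (mt hiff.1 h), hp]
  · rw [setPay_of_ne _ hl, setPay_of_ne _ hl, hp]

lemma eq_update_of_forall {w : Fin n → ℝ≥0} (h : ∀ k, k ≠ i → w k = v k) :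
    w = Function.update v i (w i) :=
  Function.eq_update_iff.2 ⟨rfl, h⟩

lemma pp_congr (M : PM n) {w : Fin n → ℝ≥0} (h : ∀ k, k ≠ i → w k = v k) :
    M.pp i w = M.pp i v := by
  rw [eq_update_of_forall h, M.indep]

lemma outcomeRev_congr {p p' : Fin n → ℝ≥0∞} {o : Option (Fin n)}
    (h : ∀ l, o = some l → p l = p' l) : outcomeRev p o = outcomeRev p' o := by
  cases o with
  | none => rfl
  | some l => simp only [outcomeRev, h l rfl]

lemma rev_of_alloc {M : PM n} {w : Fin n → ℝ≥0} {l : Fin n} (h : M.alloc w = some l) :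
    M.rev w = (M.pp l w).toReal := by
  rw [rev_eq_outcomeRev, h]; rfl

end SetPay

section OffGrid

variable {n m : ℕ} {ε : ℝ≥0} {M : PM n} {i : Fin n} {v : Fin n → ℝ≥0}

lemma le_pp_of_succOrd
    (hprev : ∀ (j : Fin n) (w : Fin n → ℝ≥0), OnGrid m ε w →
      SuccOrd j w i v → (maxOther j w : ℝ≥0∞) ≤ M.pp j w)
    {l k : Fin n} {w : Fin n → ℝ≥0} (hw : OnGrid m ε w) (hs : SuccOrd l w i v) (hk : k ≠ l) :
    (w k : ℝ≥0∞) ≤ M.pp l w :=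
  le_trans (by exact_mod_cast le_maxOther w hk) (hprev l w hw hs)

lemma le_of_pp_le
    (hprev : ∀ (j : Fin n) (w : Fin n → ℝ≥0), OnGrid m ε w →
      SuccOrd j w i v → (maxOther j w : ℝ≥0∞) ≤ M.pp j w)
    {w : Fin n → ℝ≥0} (hw : OnGrid m ε w) (hline : ∀ k, k ≠ i → w k = v k)
    {l : Fin n} (hl : l ≠ i) (h : M.pp l w ≤ w l) : w i ≤ w l := by
  by_contra! hlt
  have hs : SuccOrd l w i v := by
    rw [eq_update_of_forall hline]
    exact succOrd_update hl (hline l hl ▸ hlt)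
  have := (le_pp_of_succOrd hprev hw hs hl.symm).trans h
  exact absurd hlt (not_lt.2 (by exact_mod_cast this))

/-- When the payment of player `i` lies off the grid, revenue maximality forces a tie with a
player who pays the same, since otherwise the payment could be rounded up. -/
lemma RevMax.exists_tie {g : ℕ → ℝ} (hM : RevMax m ε g M) (hg : ∀ k ≤ m, 0 < g k) (hε : 0 < ε)
    (hprev : ∀ (j : Fin n) (w : Fin n → ℝ≥0), OnGrid m ε w →
      SuccOrd j w i v → (maxOther j w : ℝ≥0∞) ≤ M.pp j w)
    {vi : ℝ≥0} (hvi : M.pp i v = vi) (hoff : ∀ a : ℕ, vi ≠ a * ε)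
    {w : Fin n → ℝ≥0} (hw : OnGrid m ε w) (hline : ∀ k, k ≠ i → w k = v k)
    (halloc : M.alloc w = some i) :
    ∃ l, l ≠ i ∧ Valid (fun k => M.pp k w) w (some l) ∧ M.pp l w = vi := by
  by_contra! hno
  set q : ℝ≥0 := ⌈vi / ε⌉₊ * ε with hq
  have hvq : vi < q := by
    refine lt_of_le_of_ne ?_ (hoff _)
    rw [hq, ← div_le_iff₀ hε]
    exact Nat.le_ceil _
  have hqle : ∀ k : ℕ, vi ≤ k * ε → q ≤ k * ε := by
    intro k hk
    rw [hq]
    gcongr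
    rw [Nat.ceil_le, div_le_iff₀ hε]
    exact hk
  obtain ⟨M', hpp, hQ⟩ := exists_mechanism (setPay M.pp i v q) (setPay_update M.indep)
    (fun u o => OnGrid m ε u → M.rev u ≤ outcomeRev (fun l => setPay M.pp i v q l u) o ∧
      (u = w → M.rev u < outcomeRev (fun l => setPay M.pp i v q l u) o)) (by
    intro u
    by_cases hu : OnGrid m ε u
    swap
    · obtain ⟨o, ho⟩ := exists_valid (fun l => setPay M.pp i v q l u) u
      exact ⟨o, ho, fun h => absurd h hu⟩
    by_cases hul : ∀ k, k ≠ i → u k = v k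
    swap
    · refine ⟨M.alloc u, (valid_alloc M u).of_modify fun l => Or.inl (setPay_of_not hul l),
        fun _ => ⟨le_of_eq ?_, ?_⟩⟩
      · exact outcomeRev_congr fun l _ => (setPay_of_not hul l).symm
      · rintro rfl; exact absurd hline hul
    have hpi : M.pp i u = vi := (pp_congr M hul).trans hvi
    by_cases hal : M.alloc u = some i
    · have hV := valid_alloc M u
      rw [hal] at hV
      have hir := M.ir u i hal
      obtain ⟨k, -, hk⟩ := hu i
      rw [hpi] at hir
      obtain ⟨l, hl, hcase⟩ := hV.exists_of_raise (p' := fun l => setPay M.pp i v q l u)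
        (fun l hl => setPay_of_ne u hl)
        (by
          simp only [setPay_self hul]
          rw [hk] at hir ⊢
          exact_mod_cast hqle k (by exact_mod_cast hir))
        (fun l hl h => le_of_pp_le hprev hu hul hl h)
      refine ⟨some l, hl, fun _ => ?_⟩
      rw [rev_of_alloc hal, hpi]
      simp only [outcomeRev]
      rcases hcase with rfl | ⟨hli, hle, htie⟩
      · rw [setPay_self hul]
        have : (vi : ℝ) < q := hvq
        exact ⟨this.le, fun _ => this⟩
      · rw [setPay_of_ne u hli]
        have hfin : M.pp l u ≠ ⊤ := by
          have := hl.ir l rfl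
          simp only [setPay_of_ne u hli] at this
          exact ne_top_of_le_ne_top ENNReal.coe_ne_top this
        refine ⟨ENNReal.toReal_mono hfin (hpi ▸ hle), ?_⟩
        rintro rfl
        refine ENNReal.toReal_strict_mono hfin (lt_of_le_of_ne (hpi ▸ hle) fun heq => ?_)
        exact hno l hli (htie (heq.symm.trans hpi.symm)) heq.symm
    · refine ⟨M.alloc u, (valid_alloc M u).of_modify fun l => ?_, fun _ => ⟨le_of_eq ?_, ?_⟩⟩
      · by_cases hl : l = i
        · subst hl
          refine Or.inr ⟨hal, Or.inl ?_⟩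
          rw [setPay_self hul, hpi]
          exact_mod_cast hvq.le
        · exact Or.inl (setPay_of_ne u hl)
      · refine outcomeRev_congr fun l hl => (setPay_of_ne u ?_).symm
        rintro rfl; exact hal hl
      · rintro rfl; exact absurd halloc hal)
  have hrev : ∀ u, M'.rev u = outcomeRev (fun l => setPay M.pp i v q l u) (M'.alloc u) := by
    intro u; rw [rev_eq_outcomeRev, hpp]
  refine absurd (hM M') (not_le.2 (expRev_lt_of_forall_rev_le hg (fun u hu => ?_) hw ?_))
  · rw [hrev]; exact (hQ u hu).1
  · rw [hrev]; exact (hQ w hw).2 rfl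

end OffGrid

section Exchange

variable {n m : ℕ} {ε : ℝ≥0} {M : PM n} {i j : Fin n} {v : Fin n → ℝ≥0} {vi : ℝ≥0}

/-- The potential payments `M.pp`, with the payment of `i` against `v` raised by `ε` and the
payment of `j` against `v` with `i`-th entry `vi` set to `v j`. -/
noncomputable def exchangePay (M : PM n) (ε : ℝ≥0) (i j : Fin n) (v : Fin n → ℝ≥0) (vi : ℝ≥0) :
    Fin n → (Fin n → ℝ≥0) → ℝ≥0∞ :=
  setPay (setPay M.pp i v (M.pp i v + ε)) j (Function.update v i vi) (v j)

lemma exchangePay_update (l : Fin n) (w : Fin n → ℝ≥0) (r : ℝ≥0) :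
    exchangePay M ε i j v vi l (Function.update w l r) = exchangePay M ε i j v vi l w :=
  setPay_update (setPay_update M.indep) l w r

lemma exists_exchange_of_offGrid {g : ℕ → ℝ} (hM : RevMax m ε g M) (hg : ∀ k ≤ m, 0 < g k)
    (hε : 0 < ε)
    (hprev : ∀ (j : Fin n) (w : Fin n → ℝ≥0), OnGrid m ε w →
      SuccOrd j w i v → (maxOther j w : ℝ≥0∞) ≤ M.pp j w)
    (hvi : M.pp i v = vi) (hoff : ∀ a : ℕ, vi ≠ a * ε) (hji : j ≠ i) :
    ∃ M' : PM n, M'.pp = exchangePay M ε i j v vi ∧ expRev m ε g M ≤ expRev m ε g M' := by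
  obtain ⟨M', hpp, hQ⟩ := exists_mechanism (exchangePay M ε i j v vi) exchangePay_update
    (fun u o => OnGrid m ε u →
      M.rev u ≤ outcomeRev (fun l => exchangePay M ε i j v vi l u) o) (by
    intro u
    by_cases hu : OnGrid m ε u
    swap
    · obtain ⟨o, ho⟩ := exists_valid (fun l => exchangePay M ε i j v vi l u) u
      exact ⟨o, ho, fun h => absurd h hu⟩
    have hj : ¬ ∀ k, k ≠ j → u k = Function.update v i vi k := by
      intro h
      obtain ⟨k, -, hk⟩ := hu i
      have := h i hji.symm
      rw [Function.update_self] at this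
      exact hoff k (this.symm.trans hk)
    have hpay : ∀ l, exchangePay M ε i j v vi l u = setPay M.pp i v (M.pp i v + ε) l u :=
      setPay_of_not hj
    simp only [hpay]
    by_cases hul : ∀ k, k ≠ i → u k = v k
    swap
    · exact ⟨M.alloc u, (valid_alloc M u).of_modify fun l => Or.inl (setPay_of_not hul l),
        fun _ => le_of_eq (outcomeRev_congr fun l _ => (setPay_of_not hul l).symm)⟩
    have hpi : M.pp i u = M.pp i v := pp_congr M hul
    obtain ⟨o, ho, hoi, hrev⟩ : ∃ o, Valid (fun l => M.pp l u) u o ∧ o ≠ some i ∧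
        M.rev u = outcomeRev (fun l => M.pp l u) o := by
      by_cases hal : M.alloc u = some i
      · obtain ⟨l, hl, hV, hpl⟩ := hM.exists_tie hg hε hprev hvi hoff hu hul hal
        refine ⟨some l, hV, by simpa using hl, ?_⟩
        rw [rev_of_alloc hal, hpi, hvi]
        simp only [outcomeRev, hpl]
      · exact ⟨_, valid_alloc M u, hal, rfl⟩
    refine ⟨o, ho.of_modify fun l => ?_, fun _ => ?_⟩
    · by_cases hl : l = i
      · subst hl
        refine Or.inr ⟨hoi, Or.inl ?_⟩
        rw [setPay_self hul, hpi]
        exact le_self_add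
      · exact Or.inl (setPay_of_ne u hl)
    · rw [hrev]
      refine le_of_eq (outcomeRev_congr fun l hl => (setPay_of_ne u ?_).symm)
      rintro rfl; exact hoi hl)
  refine ⟨M', hpp, expRev_le_of_forall_rev_le hg fun u hu => ?_⟩
  rw [rev_eq_outcomeRev M', hpp]
  exact hQ u hu

lemma lt_pp_of_line
    (hprev : ∀ (j : Fin n) (w : Fin n → ℝ≥0), OnGrid m ε w →
      SuccOrd j w i v → (maxOther j w : ℝ≥0∞) ≤ M.pp j w)
    (hlt : vi < v j) (hjmax : ∀ k, k ≠ i → v k ≤ v j) {u : Fin n → ℝ≥0}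
    (hu : OnGrid m ε u) (huj : ∀ k, k ≠ j → u k = Function.update v i vi k) (h : v j < u j)
    {l : Fin n} (hl : l ≠ j) : (u l : ℝ≥0∞) < M.pp l u := by
  have hs : SuccOrd l u i v :=
    succOrd_of_forall_lt hl.symm fun k hk => (hjmax k hk).trans_lt h
  refine lt_of_lt_of_le ?_ (le_pp_of_succOrd hprev hu hs hl.symm)
  rw [huj l hl]
  by_cases hli : l = i
  · subst hli
    rw [Function.update_self]
    exact_mod_cast hlt.trans h
  · rw [Function.update_of_ne hli]
    exact_mod_cast (hjmax l hli).trans_lt h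

lemma exists_valid_exchange
    (hprev : ∀ (j : Fin n) (w : Fin n → ℝ≥0), OnGrid m ε w →
      SuccOrd j w i v → (maxOther j w : ℝ≥0∞) ≤ M.pp j w)
    (hvi : M.pp i v = vi) {a : ℕ} (ha : vi = a * ε) (hlt : vi < v j)
    (hall : ∀ k : Fin n, k ≠ i →
      ((Function.update v i vi) k : ℝ≥0∞) < M.pp k (Function.update v i vi))
    (hji : j ≠ i) (hjmax : ∀ k, k ≠ i → v k ≤ v j) {u : Fin n → ℝ≥0} (hu : OnGrid m ε u) :
    ∃ o, Valid (fun l => exchangePay M ε i j v vi l u) u o ∧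
      (u = Function.update v i vi →
        v j ≤ outcomeRev (fun l => exchangePay M ε i j v vi l u) o) ∧
      ((∀ k, k ≠ i → u k = v k) → v j < u i →
        M.rev u + ε ≤ outcomeRev (fun l => exchangePay M ε i j v vi l u) o) ∧
      ((∀ k, k ≠ j → u k = Function.update v i vi k) → v j < u j →
        v j ≤ outcomeRev (fun l => exchangePay M ε i j v vi l u) o) ∧
      (¬ ((∀ k, k ≠ j → u k = Function.update v i vi k) ∧ v j < u j) →
        M.rev u ≤ outcomeRev (fun l => exchangePay M ε i j v vi l u) o) := by
  set w₀ := Function.update v i vi with hw₀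
  have hw₀j : w₀ j = v j := Function.update_of_ne hji _ _
  have hw₀i : w₀ i = vi := Function.update_self _ _ _
  have hpj := hall j hji
  rw [hw₀j] at hpj
  by_cases hul : ∀ k, k ≠ i → u k = v k
  · have huj : u j = v j := hul j hji
    have hpi : M.pp i u = vi := (pp_congr M hul).trans hvi
    by_cases hui : u i = vi
    · have huw : u = w₀ := by rw [eq_update_of_forall hul, hui]
      have hline : ∀ k, k ≠ j → u k = w₀ k := fun k _ => by rw [huw]
      have hpayj : exchangePay M ε i j v vi j u = v j := setPay_self hline
      have hpayi : exchangePay M ε i j v vi i u = vi + ε := by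
        rw [exchangePay, setPay_of_ne _ hji.symm, setPay_self hul, hvi]
      have hpay : ∀ l, l ≠ i → l ≠ j → exchangePay M ε i j v vi l u = M.pp l u :=
        fun l hli hlj => by rw [exchangePay, setPay_of_ne _ hlj, setPay_of_ne _ hli]
      have hge : ∀ l, (u l : ℝ≥0∞) ≤ exchangePay M ε i j v vi l u := by
        intro l
        by_cases hli : l = i
        · subst hli
          rw [hpayi, hui]
          exact le_self_add
        · by_cases hlj : l = j
          · subst hlj; rw [hpayj, huj]
          · rw [hpay l hli hlj, huw]
            exact (hall l hli).le
      refine ⟨some j, ⟨?_, ?_, by simp⟩, ?_, ?_, ?_, ?_⟩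
      · rintro _ ⟨⟩
        simp only [hpayj, huj, le_refl]
      · rintro _ ⟨⟩ l
        simp only [hpayj, huj]
        rw [add_comm]
        gcongr
        exact hge l
      · intro _
        simp only [outcomeRev, hpayj, ENNReal.coe_toReal, le_refl]
      · intro _ h
        exact absurd h (not_lt.2 (hui ▸ hlt.le))
      · intro _ h
        exact absurd h (not_lt.2 huj.le)
      · intro _
        simp only [outcomeRev, hpayj, ENNReal.coe_toReal]
        cases hal : M.alloc u with
        | none => simp [rev_eq_outcomeRev, hal, outcomeRev]
        | some l =>
          have hir := M.ir u l hal
          have hl : l = i := by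
            by_contra hli
            rw [huw] at hir
            exact absurd hir (not_le.2 (hall l hli))
          subst hl
          rw [rev_of_alloc hal, hpi, ENNReal.coe_toReal]
          exact_mod_cast hlt.le
    · have hnj : ¬ ∀ k, k ≠ j → u k = w₀ k := fun h => hui ((h i hji.symm).trans hw₀i)
      have hpayi : exchangePay M ε i j v vi i u = vi + ε := by
        rw [exchangePay, setPay_of_not hnj, setPay_self hul, hvi]
      have hpay : ∀ l, l ≠ i → exchangePay M ε i j v vi l u = M.pp l u :=
        fun l hli => by rw [exchangePay, setPay_of_not hnj, setPay_of_ne _ hli]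
      have huw : u ≠ w₀ := fun h => hui (by rw [h, hw₀i])
      by_cases hal : M.alloc u = some i
      · have hV := valid_alloc M u
        rw [hal] at hV
        have hir := M.ir u i hal
        rw [hpi] at hir
        have hle : vi + ε ≤ u i := by
          obtain ⟨k, -, hk⟩ := hu i
          have hlt' : vi < u i := lt_of_le_of_ne (by exact_mod_cast hir) (Ne.symm hui)
          rw [hk, ha] at hlt' ⊢
          have hak : a + 1 ≤ k := Nat.succ_le_of_lt (by
            exact_mod_cast lt_of_mul_lt_mul_right hlt' ε.2)
          calc (a : ℝ≥0) * ε + ε = ((a + 1 : ℕ) : ℝ≥0) * ε := by push_cast; ring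
            _ ≤ k * ε := by gcongr
        obtain ⟨l, hl, hcase⟩ := hV.exists_of_raise
          (p' := fun l => exchangePay M ε i j v vi l u) hpay
          (by simp only [hpayi]; exact_mod_cast hle)
          (fun l hl h => le_of_pp_le hprev hu hul hl h)
        refine ⟨some l, hl, fun h => absurd h huw, fun _ hlt' => ?_, fun h => absurd h hnj,
          fun _ => ?_⟩
        · have hli : l = i := by
            by_contra hli
            have h1 := hl.ir l rfl
            simp only [hpay l hli] at h1
            have h2 := le_of_pp_le hprev hu hul hli h1
            rw [hul l hli] at h2
            exact absurd (h2.trans (hjmax l hli)) (not_le.2 hlt')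
          subst hli
          rw [rev_of_alloc hal, hpi]
          simp only [outcomeRev, hpayi]
          rw [ENNReal.toReal_add ENNReal.coe_ne_top ENNReal.coe_ne_top]
          simp
        · rw [rev_of_alloc hal, hpi]
          simp only [outcomeRev]
          rcases hcase with rfl | ⟨hli, hle', -⟩
          · rw [hpayi, ENNReal.toReal_add ENNReal.coe_ne_top ENNReal.coe_ne_top]
            simp
          · have h1 := hl.ir l rfl
            simp only [hpay l hli] at h1
            rw [hpay l hli]
            exact ENNReal.toReal_mono (ne_top_of_le_ne_top ENNReal.coe_ne_top h1) (hpi ▸ hle')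
      · refine ⟨M.alloc u, (valid_alloc M u).of_modify fun l => ?_, fun h => absurd h huw,
          fun _ hlt' => ?_, fun h => absurd h hnj, fun _ => le_of_eq ?_⟩
        · by_cases hl : l = i
          · subst hl
            refine Or.inr ⟨hal, Or.inl ?_⟩
            rw [hpayi, hpi]
            exact le_self_add
          · exact Or.inl (hpay l hl)
        · exfalso
          have hwin : M.pp i u < u i := by
            rw [hpi]
            exact_mod_cast hlt.trans hlt'
          obtain ⟨l, hl⟩ := Option.ne_none_iff_exists'.1 (M.sells u ⟨i, hwin⟩)
          have hli : l ≠ i := by rintro rfl; exact hal hl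
          have h2 := le_of_pp_le hprev hu hul hli (M.ir u l hl)
          rw [hul l hli] at h2
          exact absurd (h2.trans (hjmax l hli)) (not_le.2 hlt')
        · refine outcomeRev_congr fun l hl => (hpay l ?_).symm
          rintro rfl; exact hal hl
  · have huw : u ≠ w₀ := by
      rintro rfl
      exact hul fun k hk => Function.update_of_ne hk _ _
    by_cases huj : ∀ k, k ≠ j → u k = w₀ k
    · have hne : u j ≠ v j := by
        intro h
        refine hul fun k hk => ?_
        by_cases hkj : k = j
        · rw [hkj, h]
        · rw [huj k hkj, hw₀, Function.update_of_ne hk]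
      have hpayj : exchangePay M ε i j v vi j u = v j := setPay_self huj
      have hpay : ∀ l, l ≠ j → exchangePay M ε i j v vi l u = M.pp l u :=
        fun l hlj => by rw [exchangePay, setPay_of_ne _ hlj, setPay_of_not hul]
      rcases lt_or_gt_of_ne hne with hlt' | hgt
      · have hpj' : (v j : ℝ≥0∞) < M.pp j u := by rwa [pp_congr M huj]
        have hal : M.alloc u ≠ some j := by
          intro hal
          have := hpj'.trans_le (M.ir u j hal)
          exact absurd hlt' (not_lt.2 (by exact_mod_cast this.le))
        refine ⟨M.alloc u, (valid_alloc M u).of_modify fun l => ?_, fun h => absurd h huw,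
          fun h => absurd h hul, fun _ h => absurd h (not_lt.2 hlt'.le), fun _ => le_of_eq ?_⟩
        · by_cases hl : l = j
          · subst hl
            refine Or.inr ⟨hal, Or.inr ?_⟩
            rw [hpayj]
            exact_mod_cast hlt'.le
          · exact Or.inl (hpay l hl)
        · refine outcomeRev_congr fun l hl => (hpay l ?_).symm
          rintro rfl; exact hal hl
      · refine ⟨some j, ⟨?_, ?_, by simp⟩, fun h => absurd h huw, fun h => absurd h hul,
          fun _ _ => ?_, fun h => absurd ⟨huj, hgt⟩ h⟩
        · rintro _ ⟨⟩
          simp only [hpayj]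
          exact_mod_cast hgt.le
        · rintro _ ⟨⟩ l
          by_cases hl : l = j
          · rw [hl]
          · simp only [hpayj, hpay l hl]
            rw [add_comm]
            gcongr
            exact (lt_pp_of_line hprev hlt hjmax hu huj hgt hl).le
        · simp only [outcomeRev, hpayj, ENNReal.coe_toReal, le_refl]
    · have hpay : ∀ l, exchangePay M ε i j v vi l u = M.pp l u :=
        fun l => by rw [exchangePay, setPay_of_not huj, setPay_of_not hul]
      exact ⟨M.alloc u, (valid_alloc M u).of_modify fun l => Or.inl (hpay l),
        fun h => absurd h huw, fun h => absurd h hul, fun h => absurd h huj,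
        fun _ => le_of_eq (outcomeRev_congr fun l _ => (hpay l).symm)⟩

lemma exists_exchange_of_onGrid {g : ℕ → ℝ} (hε : 0 < ε) (hg : ∀ k ≤ m, 0 < g k)
    (hgsum : ∑ k ∈ range (m + 1), g k = 1) (hstd : StandardD m ε g)
    {x : ℕ} (hx : MonopolistIdx m ε g x) (hv : OnGrid m ε v) (hvx : x * ε ≤ v j)
    (hprev : ∀ (j : Fin n) (w : Fin n → ℝ≥0), OnGrid m ε w →
      SuccOrd j w i v → (maxOther j w : ℝ≥0∞) ≤ M.pp j w)
    (hvi : M.pp i v = vi) {a : ℕ} (ha : vi = a * ε) (hlt : vi < v j)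
    (hall : ∀ k : Fin n, k ≠ i →
      ((Function.update v i vi) k : ℝ≥0∞) < M.pp k (Function.update v i vi))
    (hji : j ≠ i) (hjmax : ∀ k, k ≠ i → v k ≤ v j) :
    ∃ M' : PM n, M'.pp = exchangePay M ε i j v vi ∧ expRev m ε g M ≤ expRev m ε g M' := by
  obtain ⟨M', hpp, hQ⟩ := exists_mechanism (exchangePay M ε i j v vi) exchangePay_update
    (fun u o => OnGrid m ε u →
      (u = Function.update v i vi →
        v j ≤ outcomeRev (fun l => exchangePay M ε i j v vi l u) o) ∧
      ((∀ k, k ≠ i → u k = v k) → v j < u i →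
        M.rev u + ε ≤ outcomeRev (fun l => exchangePay M ε i j v vi l u) o) ∧
      ((∀ k, k ≠ j → u k = Function.update v i vi k) → v j < u j →
        v j ≤ outcomeRev (fun l => exchangePay M ε i j v vi l u) o) ∧
      (¬ ((∀ k, k ≠ j → u k = Function.update v i vi k) ∧ v j < u j) →
        M.rev u ≤ outcomeRev (fun l => exchangePay M ε i j v vi l u) o)) (by
    intro u
    by_cases hu : OnGrid m ε u
    · obtain ⟨o, ho, hrest⟩ := exists_valid_exchange hprev hvi ha hlt hall hji hjmax hu
      exact ⟨o, ho, fun _ => hrest⟩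
    · obtain ⟨o, ho⟩ := exists_valid (fun l => exchangePay M ε i j v vi l u) u
      exact ⟨o, ho, fun h => absurd h hu⟩)
  refine ⟨M', hpp, ?_⟩
  have hrev' : ∀ u, outcomeRev (fun l => exchangePay M ε i j v vi l u) (M'.alloc u) =
      M'.rev u := by
    intro u; rw [rev_eq_outcomeRev, hpp]
  simp only [hrev'] at hQ
  have hcoe : ∀ {s t : ℕ}, (s : ℝ≥0) * ε < t * ε ↔ s < t := by
    intro s t
    rw [mul_lt_mul_iff_left₀ hε, Nat.cast_lt]
  choose κ hκm hκ using hv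
  have hab : a < κ j := by
    rw [ha, hκ j] at hlt
    exact hcoe.1 hlt
  set K : Fin n → Fin (m + 1) := Function.update (fun l => ⟨κ l, Nat.lt_succ_iff.2 (hκm l)⟩) i
    ⟨a, by have := hκm j; omega⟩ with hK
  have hKi : ((K i : Fin (m + 1)) : ℕ) = a := by rw [hK, Function.update_self]
  have hKne : ∀ l, l ≠ i → ((K l : Fin (m + 1)) : ℕ) = κ l := by
    intro l hl; rw [hK, Function.update_of_ne hl]
  have hKj := hKne j hji
  have hvec : (fun l => ((K l : ℕ) : ℝ≥0) * ε) = Function.update v i vi := by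
    refine Function.eq_update_iff.2 ⟨by simp only [hKi, ha], fun l hl => ?_⟩
    simp only [hKne l hl, hκ l]
  have hvecl := congrFun hvec
  have hvj : v j = (K j : ℕ) * ε := by rw [hKj, hκ j]
  have hvjR : (v j : ℝ) = (K j : ℕ) * ε := by rw [hvj]; push_cast; ring
  refine expRev_le_of_lines hg hji K (by rw [hKi, hKj]; exact hab)
    (fun s => if M.pp j (Function.update v i vi) ≤ ((s * ε : ℝ≥0) : ℝ≥0∞) then
      (M.pp j (Function.update v i vi)).toReal else 0) ?_ ?_ ?_ ?_ ?_
  · have hgrid := onGrid_vec (ε := ε) K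
    have h1 := (hQ _ hgrid).1 hvec
    have h2 : M.rev (fun l => ((K l : ℕ) : ℝ≥0) * ε) ≤ (K i : ℕ) * ε := by
      rw [hvec]
      cases hal : M.alloc (Function.update v i vi) with
      | none =>
        rw [rev_eq_outcomeRev, hal]
        simp only [outcomeRev]
        positivity
      | some l =>
        have hl : l = i := by
          by_contra hli
          exact absurd (M.ir _ l hal) (not_le.2 (hall l hli))
        subst hl
        rw [rev_of_alloc hal, M.indep, hvi, hKi, ha]
        simp
    rw [hvjR] at h1
    linarith
  · intro t ht
    refine (hQ _ (onGrid_vec _)).2.1 (fun k hk => ?_) ?_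
    · rw [Function.update_of_ne hk, hKne k hk, hκ k]
    · rw [Function.update_self, hvj]
      exact hcoe.2 ht
  · intro s hs
    set u : Fin n → ℝ≥0 := fun l => ((Function.update K j s l : ℕ) : ℝ≥0) * ε with hu
    have huj : ∀ k, k ≠ j → u k = Function.update v i vi k := by
      intro k hk
      rw [hu, ← hvecl]
      simp only [Function.update_of_ne hk]
    have huself : u j = s * ε := by simp only [hu, Function.update_self]
    have hgt : v j < u j := by
      rw [huself, hvj]
      exact hcoe.2 hs
    have hgrid : OnGrid m ε u := onGrid_vec _
    have h1 := (hQ u hgrid).2.2.1 huj hgt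
    have h2 : M.rev u ≤ if M.pp j (Function.update v i vi) ≤ ((s * ε : ℝ≥0) : ℝ≥0∞) then
        (M.pp j (Function.update v i vi)).toReal else 0 := by
      cases hal : M.alloc u with
      | none =>
        rw [rev_eq_outcomeRev, hal]
        simp only [outcomeRev]
        split_ifs <;> simp
      | some l =>
        have hl : l = j := by
          by_contra hlj
          exact absurd (M.ir _ l hal)
            (not_le.2 (lt_pp_of_line hprev hlt hjmax hgrid huj hgt hlj))
        subst hl
        have hir := M.ir u l hal
        rw [pp_congr M huj, huself] at hir
        rw [if_pos hir, rev_of_alloc hal, pp_congr M huj]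
    rw [hvjR] at h1
    linarith
  · intro k hk
    refine (hQ _ (onGrid_vec k)).2.2.2 ?_
    rintro ⟨h1, h2⟩
    refine hk ⟨k j, ?_, ?_⟩
    · rw [hvj] at h2
      exact hcoe.1 h2
    · refine (Function.eq_update_iff.2 ⟨rfl, fun l hl => ?_⟩).symm
      have h3 := h1 l hl
      rw [← hvecl] at h3
      have h4 := mul_right_cancel₀ hε.ne' h3
      exact Fin.ext (by exact_mod_cast h4)
  · rw [hKi]
    refine line_gain_nonneg hstd hε hg hgsum hx ?_ (by rw [hKj]; exact hab)
      (by rw [hKj]; exact hκm j) _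
    rw [hvj] at hvx
    exact_mod_cast le_of_mul_le_mul_right hvx hε

end Exchange

end PM

theorem stmt15 (n m : ℕ) (hm : 0 < m) (ε : ℝ≥0) (hε : (ε : ℝ) = 1 / m)
    (g : ℕ → ℝ) (hgpos : ∀ k ≤ m, 0 < g k)
    (hgsum : ∑ k ∈ Finset.range (m + 1), g k = 1)
    (hstd : PM.StandardD m ε g)
    (x : ℕ) (hx : PM.MonopolistIdx m ε g x)
    (M : PM n) (hMmax : PM.RevMax m ε g M)
    (i : Fin n) (v : Fin n → ℝ≥0) (hv : PM.OnGrid m ε v)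
    (hvx : (x : ℝ≥0) * ε ≤ PM.maxOther i v)
    (hprev : ∀ (j : Fin n) (w : Fin n → ℝ≥0), PM.OnGrid m ε w →
      PM.SuccOrd j w i v → (PM.maxOther j w : ℝ≥0∞) ≤ M.pp j w)
    (hlt : M.pp i v < (PM.maxOther i v : ℝ≥0∞))
    (vi : ℝ≥0) (hvi : M.pp i v = (vi : ℝ≥0∞))
    (hall : ∀ k : Fin n, k ≠ i →
      ((Function.update v i vi) k : ℝ≥0∞) < M.pp k (Function.update v i vi))
    (j : Fin n) (hji : j ≠ i) (hjmax : ∀ k, k ≠ i → v k ≤ v j) :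
    ∃ M' : PM n,
      (∀ (l : Fin n) (w : Fin n → ℝ≥0), l ≠ i → l ≠ j → M'.pp l w = M.pp l w) ∧
      (∀ w : Fin n → ℝ≥0,
        ((∀ l, l ≠ i → w l = v l) → M'.pp i w = M.pp i v + (ε : ℝ≥0∞)) ∧
        ((¬ ∀ l, l ≠ i → w l = v l) → M'.pp i w = M.pp i w)) ∧
      (∀ w : Fin n → ℝ≥0,
        ((∀ l, l ≠ j → w l = Function.update v i vi l) → M'.pp j w = (v j : ℝ≥0∞)) ∧
        ((¬ ∀ l, l ≠ j → w l = Function.update v i vi l) → M'.pp j w = M.pp j w)) ∧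
      PM.expRev m ε g M ≤ PM.expRev m ε g M' := by
  classical
  have hε0 : 0 < ε := by
    rw [← NNReal.coe_pos, hε]
    positivity
  have hmax : PM.maxOther i v = v j := by
    refine le_antisymm (Finset.sup_le fun k hk => hjmax k (Finset.ne_of_mem_erase hk)) ?_
    exact PM.le_maxOther v hji
  rw [hmax] at hvx hlt
  have hlt' : vi < v j := by
    rw [hvi] at hlt
    exact_mod_cast hlt
  obtain ⟨M', hpp, hrev⟩ : ∃ M' : PM n, M'.pp = PM.exchangePay M ε i j v vi ∧
      PM.expRev m ε g M ≤ PM.expRev m ε g M' := by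
    by_cases hgrid : ∃ a : ℕ, vi = a * ε
    · obtain ⟨a, ha⟩ := hgrid
      exact PM.exists_exchange_of_onGrid hε0 hgpos hgsum hstd hx hv hvx hprev hvi ha hlt' hall
        hji hjmax
    · push Not at hgrid
      exact PM.exists_exchange_of_offGrid hMmax hgpos hε0 hprev hvi hgrid hji
  refine ⟨M', fun l w hli hlj => ?_, fun w => ⟨fun h => ?_, fun h => ?_⟩,
    fun w => ⟨fun h => ?_, fun h => ?_⟩, hrev⟩ <;> rw [hpp, PM.exchangePay]
  · rw [PM.setPay_of_ne w hlj, PM.setPay_of_ne w hli]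
  · rw [PM.setPay_of_ne w hji.symm, PM.setPay_self h]
  · rw [PM.setPay_of_ne w hji.symm, PM.setPay_of_not h]
  · rw [PM.setPay_self h]
  · rw [PM.setPay_of_not h, PM.setPay_of_ne w hji]
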